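/- Let λ : ℝ → ℝ be a C¹ positive function, f : ℝ² → ℝ a C¹ function, and Ω : ℝ² → ℝ a function. Set H(u,v,p₁,p₂) = (p₁² + p₂²)/(2λ(v)) and F(u,v,p₁,p₂) = p₁ + f(u,v). Then {F,H}_mg vanishes identically (for all (u,v,p₁,p₂)) if and only if f_u ≡ 0 and Ω(u,v) ≡ −f_v(u,v); that is, a linear integral of the form p₁ + f forces f to depend only on v and the magnetic field to equal −f'(v). -/

import Mathlib

open Real

/-- Partial derivative in the first variable of a function on `ℝ²`. -/
noncomputable def pdx (f : ℝ × ℝ → ℝ) (p : ℝ × ℝ) : ℝ := deriv (fun t => f (t, p.2)) p.1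

/-- Partial derivative in the second variable of a function on `ℝ²`. -/
noncomputable def pdy (f : ℝ × ℝ → ℝ) (p : ℝ × ℝ) : ℝ := deriv (fun t => f (p.1, t)) p.2

/-- The magnetic Poisson bracket of two functions `F`, `H` of `(u, v, p₁, p₂)` with
magnetic field `Ω(u,v)`. -/
noncomputable def magneticBracket (Ω : ℝ → ℝ → ℝ) (F H : ℝ → ℝ → ℝ → ℝ → ℝ)
    (u v p₁ p₂ : ℝ) : ℝ :=
  deriv (fun t => F t v p₁ p₂) u * deriv (fun t => H u v t p₂) p₁
    - deriv (fun t => F u v t p₂) p₁ * deriv (fun t => H t v p₁ p₂) u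
    + deriv (fun t => F u t p₁ p₂) v * deriv (fun t => H u v p₁ t) p₂
    - deriv (fun t => F u v p₁ t) p₂ * deriv (fun t => H u t p₁ p₂) v
    + Ω u v * (deriv (fun t => F u v t p₂) p₁ * deriv (fun t => H u v p₁ t) p₂
      - deriv (fun t => F u v p₁ t) p₂ * deriv (fun t => H u v t p₂) p₁)

/-- The bracket of `p₁ + f(u,v)` with the kinetic Hamiltonian `(p₁² + p₂²)/(2λ(v))`. -/
theorem magneticBracket_linear_kinetic (lam : ℝ → ℝ) (f : ℝ × ℝ → ℝ) (Ω : ℝ → ℝ → ℝ)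
    (u v p₁ p₂ : ℝ) :
    magneticBracket Ω (fun u v p₁ _ => p₁ + f (u, v))
        (fun _ v p₁ p₂ => (p₁ ^ 2 + p₂ ^ 2) / (2 * lam v)) u v p₁ p₂
      = (pdx f (u, v) * p₁ + (pdy f (u, v) + Ω u v) * p₂) / lam v := by
  simp only [magneticBracket, pdx, pdy, deriv_div_const, deriv_const_add, deriv_add_const,
    deriv_const, deriv_pow_field, deriv_id'']
  push_cast
  ring

/-- For the metric `ds² = λ(v)(du² + dv²)` with `λ` a `C¹` positive function,
a `C¹` function `f` on `ℝ²` and a magnetic field `Ω`, the function `F = p₁ + f(u,v)` satisfies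
`{F,H}_mg ≡ 0` for `H = (p₁² + p₂²)/(2λ(v))` if and only if `f_u ≡ 0` and `Ω ≡ −f_v`. -/
theorem statement3 (lam : ℝ → ℝ) (hlam : ContDiff ℝ 1 lam) (hpos : ∀ v, 0 < lam v)
    (f : ℝ × ℝ → ℝ) (hf : ContDiff ℝ 1 f) (Ω : ℝ × ℝ → ℝ) :
    (∀ u v p₁ p₂ : ℝ,
        magneticBracket (fun u v => Ω (u, v))
          (fun u v p₁ _ => p₁ + f (u, v))
          (fun _ v p₁ p₂ => (p₁ ^ 2 + p₂ ^ 2) / (2 * lam v)) u v p₁ p₂ = 0)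
      ↔ (∀ p : ℝ × ℝ, pdx f p = 0 ∧ Ω p = -pdy f p) := by
  simp only [magneticBracket_linear_kinetic, div_eq_zero_iff, (hpos _).ne', or_false]
  constructor
  · rintro h ⟨u, v⟩
    have h₁ := h u v 1 0
    have h₂ := h u v 0 1
    constructor <;> linarith
  · intro h u v p₁ p₂
    obtain ⟨hx, hΩ⟩ := h (u, v)
    rw [hx, hΩ]
    ring
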